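/- Let I ∈ ℍ be an imaginary unit, let (a_k)_{k≥1} be a sequence on the slice L_I with ‖a_k‖ < 1, let c : ℕ → ℍ satisfy ∑_{m≥0} ‖c_m‖² < ∞, and let f(q) = ∑_{m≥0} qᵐ·c_m for q ∈ 𝔹. Fix n ≥ 1. Then for each k ∈ {1, …, n} the limit ⟨f, Φ_k⟩ := lim_{r→1⁻} (1/(2π))·∫₀^{2π} conj(Φ_k(r·e^{Iθ}))·f(r·e^{Iθ}) dθ exists in ℍ, and the projection P_n f(z) = ∑_{k=1}^{n} Φ_k(z)·⟨f, Φ_k⟩ interpolates f at the parameter points of the slice: for every ℓ ∈ {1, …, n}, ∑_{k=1}^{n} Φ_k(a_ℓ)·⟨f, Φ_k⟩ = f(a_ℓ). (This is Theorem 5.1: the restriction of the projection operator onto the span of the first n slice regular Malmquist–Takenaka functions to the slice 𝔹_I interpolates f at the points a_1, …, a_n.) -/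

import Mathlib

open scoped Real
noncomputable section

/-- The classical quaternionic Blaschke function `B_a(q) = (1 - q·conj(a))⁻¹·(q - a)`. -/
def B (a q : Quaternion ℝ) : Quaternion ℝ := (1 - q * star a)⁻¹ * (q - a)

/-- The classical quaternionic Malmquist–Takenaka functions
`Φ_n(q) = √(1 - ‖a_n‖²)·(∏_{k=1}^{n-1} B_{a_k}(q))·(1 - q·conj(a_n))⁻¹`,
the product taken in increasing order of `k`. -/
def Phi (a : ℕ → Quaternion ℝ) (n : ℕ) (q : Quaternion ℝ) : Quaternion ℝ :=
  (Real.sqrt (1 - ‖a n‖ ^ 2) : Quaternion ℝ) *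
    (((List.range (n - 1)).map (fun k => B (a (k + 1)) q)).prod) *
    (1 - q * star (a n))⁻¹

/-- `e^{Iθ} = cos θ + (sin θ)•I`. -/
def expI (I : Quaternion ℝ) (θ : ℝ) : Quaternion ℝ :=
  (Real.cos θ : Quaternion ℝ) + Real.sin θ • I

open Complex Metric Filter Topology ComplexConjugate

/-- The complex Blaschke factor `(1 - z·conj(a))⁻¹·(z - a)`. -/
def complexBlaschke (a z : ℂ) : ℂ := (1 - z * conj a)⁻¹ * (z - a)

/-- The complex Malmquist–Takenaka functions. -/
def complexMT (α : ℕ → ℂ) (n : ℕ) (z : ℂ) : ℂ :=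
  (Real.sqrt (1 - ‖α n‖ ^ 2) : ℂ) * (∏ k ∈ Finset.range (n - 1), complexBlaschke (α (k + 1)) z) *
    (1 - z * conj (α n))⁻¹

lemma one_sub_mul_ne_zero_of_norm_mul_lt_one {z w : ℂ} (h : ‖z‖ * ‖w‖ < 1) : 1 - z * w ≠ 0 := by
  intro h0
  have : ‖z * w‖ = 1 := by rw [← sub_eq_zero.1 h0, norm_one]
  rw [norm_mul] at this
  linarith

lemma one_sub_mul_conj_ne_zero {a z : ℂ} (ha : ‖a‖ < 1) (hz : ‖z‖ ≤ 1) : 1 - z * conj a ≠ 0 := by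
  apply one_sub_mul_ne_zero_of_norm_mul_lt_one
  rw [RCLike.norm_conj]
  nlinarith [norm_nonneg a, norm_nonneg z]

/-- The Christoffel–Darboux identity for a single Blaschke factor. -/
lemma one_sub_complexBlaschke_mul_conj {a z w : ℂ} (ha : ‖a‖ < 1) (hz : ‖z‖ ≤ 1) (hw : ‖w‖ ≤ 1) :
    1 - complexBlaschke a z * conj (complexBlaschke a w) =
      (1 - z * conj w) * (((1 - ‖a‖ ^ 2 : ℝ) : ℂ) * (1 - z * conj a)⁻¹ *
        conj ((1 - w * conj a)⁻¹)) := by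
  have h1 := one_sub_mul_conj_ne_zero ha hz
  have h2 := (map_ne_zero (starRingEnd ℂ)).2 (one_sub_mul_conj_ne_zero ha hw)
  simp only [map_sub, map_one, map_mul, conj_conj] at h2
  simp only [complexBlaschke, map_mul, map_inv₀, map_sub, map_one, conj_conj]
  push_cast
  rw [← Complex.mul_conj']
  generalize conj a = a', conj w = w' at *
  rw [mul_comm] at h2
  field_simp
  ring

/-- The Christoffel–Darboux formula for the Malmquist–Takenaka system. -/
lemma one_sub_mul_sum_complexMT {α : ℕ → ℂ} (hα : ∀ k, 1 ≤ k → ‖α k‖ < 1) (n : ℕ) {z w : ℂ}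
    (hz : ‖z‖ ≤ 1) (hw : ‖w‖ ≤ 1) :
    (1 - z * conj w) * ∑ k ∈ Finset.Icc 1 n, complexMT α k z * conj (complexMT α k w) =
      1 - (∏ k ∈ Finset.range n, complexBlaschke (α (k + 1)) z) *
        conj (∏ k ∈ Finset.range n, complexBlaschke (α (k + 1)) w) := by
  induction n with
  | zero => simp
  | succ n ih =>
    have ha := hα (n + 1) n.succ_pos
    have hs : ((Real.sqrt (1 - ‖α (n + 1)‖ ^ 2) : ℝ) : ℂ) * (Real.sqrt (1 - ‖α (n + 1)‖ ^ 2) : ℝ) =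
        ((1 - ‖α (n + 1)‖ ^ 2 : ℝ) : ℂ) := by
      rw [← ofReal_mul, Real.mul_self_sqrt]
      nlinarith [norm_nonneg (α (n + 1))]
    have hb := one_sub_complexBlaschke_mul_conj ha hz hw
    rw [Finset.sum_Icc_succ_top (by omega), mul_add, ih, Finset.prod_range_succ,
      Finset.prod_range_succ]
    simp only [complexMT, map_mul, Nat.add_sub_cancel, conj_ofReal]
    rw [← hs] at hb
    linear_combination (-(∏ k ∈ Finset.range n, complexBlaschke (α (k + 1)) z) *
        conj (∏ k ∈ Finset.range n, complexBlaschke (α (k + 1)) w)) * hb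

/-- At a parameter point the Malmquist–Takenaka kernel agrees with the Szegő kernel. -/
lemma sum_complexMT_mul_conj {α : ℕ → ℂ} (hα : ∀ k, 1 ≤ k → ‖α k‖ < 1) {n l : ℕ}
    (hl : l ∈ Finset.Icc 1 n) {w : ℂ} (hw : ‖w‖ ≤ 1) :
    ∑ k ∈ Finset.Icc 1 n, complexMT α k (α l) * conj (complexMT α k w) =
      (1 - α l * conj w)⁻¹ := by
  rw [Finset.mem_Icc] at hl
  have h := one_sub_mul_sum_complexMT hα n (hα l hl.1).le hw
  rw [Finset.prod_eq_zero (i := l - 1) (Finset.mem_range.2 (by omega))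
    (by simp [complexBlaschke, Nat.sub_add_cancel hl.1]), zero_mul, sub_zero] at h
  exact eq_inv_of_mul_eq_one_right h

lemma exists_differentiableOn_complexMT {α : ℕ → ℂ} (hα : ∀ k, 1 ≤ k → ‖α k‖ < 1) {n : ℕ}
    (hn : 1 ≤ n) : ∃ R > 1, DifferentiableOn ℂ (complexMT α n) (ball 0 R) := by
  obtain ⟨ρ, hρ0, hρ1, hρ⟩ : ∃ ρ : ℝ, 0 < ρ ∧ ρ < 1 ∧ ∀ k ∈ Finset.Icc 1 n, ‖α k‖ < ρ := by
    have := (Finset.eventually_all (Finset.Icc 1 n) (l := 𝓝[<] (1 : ℝ))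
      (p := fun k ρ => ‖α k‖ < ρ)).2 fun k hk =>
        mem_of_superset (Ioo_mem_nhdsLT (hα k (Finset.mem_Icc.1 hk).1)) fun x hx => hx.1
    obtain ⟨ρ, h1, h2⟩ := (this.and (Ioo_mem_nhdsLT (zero_lt_one' ℝ))).exists
    exact ⟨ρ, h2.1, h2.2, h1⟩
  have key : ∀ k ∈ Finset.Icc 1 n, ∀ z ∈ ball (0 : ℂ) ρ⁻¹, 1 - z * conj (α k) ≠ 0 := by
    intro k hk z hz
    rw [mem_ball_zero_iff] at hz
    apply one_sub_mul_ne_zero_of_norm_mul_lt_one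
    rw [RCLike.norm_conj]
    calc ‖z‖ * ‖α k‖ ≤ ‖z‖ * ρ := by gcongr; exact (hρ k hk).le
      _ < ρ⁻¹ * ρ := by gcongr
      _ = 1 := inv_mul_cancel₀ hρ0.ne'
  refine ⟨ρ⁻¹, (one_lt_inv₀ hρ0).2 hρ1, ?_⟩
  have hd : ∀ k ∈ Finset.Icc 1 n,
      DifferentiableOn ℂ (fun z => (1 - z * conj (α k))⁻¹) (ball 0 ρ⁻¹) := fun k hk =>
    DifferentiableOn.inv (by fun_prop) (key k hk)
  unfold complexMT complexBlaschke
  refine ((differentiableOn_const _).mul (DifferentiableOn.fun_finsetProd fun k hk => ?_)).mul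
    (hd n (by simp [hn]))
  have := hd (k + 1) (by simp at hk ⊢; omega)
  fun_prop

section CircleAverage

variable {E : Type*} [NormedAddCommGroup E] [NormedSpace ℂ E]

lemma circleAverage_eq_of_differentiableOn_annulus {g : ℂ → E} {s r : ℝ} (hs : 0 < s) (hsr : s ≤ r)
    (hg : ∀ z : ℂ, s ≤ ‖z‖ → ‖z‖ ≤ r → DifferentiableAt ℂ g z) :
    Real.circleAverage g 0 r = Real.circleAverage g 0 s := by
  rw [Real.circleAverage_eq_circleIntegral hs.ne',
    Real.circleAverage_eq_circleIntegral (hs.trans_le hsr).ne',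
    circleIntegral_sub_center_inv_smul_eq_of_differentiable_on_annulus_off_countable hs hsr
      Set.countable_empty]
  · rintro z ⟨hz1, hz2⟩
    simp only [mem_closedBall_zero_iff, mem_ball_zero_iff, not_lt] at hz1 hz2
    exact (hg z hz2 hz1).continuousAt.continuousWithinAt
  · rintro z ⟨⟨hz1, hz2⟩, -⟩
    simp only [mem_closedBall_zero_iff, mem_ball_zero_iff, not_le] at hz1 hz2
    exact hg z hz2.le hz1.le

/-- For `Ψ` holomorphic beyond the closed unit disc and `F` holomorphic in the open disc, the
circle averages of `conj Ψ • F` converge as the radius tends to `1`. -/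
lemma exists_tendsto_circleAverage_conj_smul {Ψ : ℂ → ℂ} {F : ℂ → E} {R : ℝ} (hR : 1 < R)
    (hΨ : DifferentiableOn ℂ Ψ (ball 0 R)) (hF : DifferentiableOn ℂ F (ball 0 1)) :
    ∃ L, Tendsto (fun r : ℝ => Real.circleAverage (fun w => conj (Ψ w) • F w) 0 r)
      (𝓝[<] 1) (𝓝 L) := by
  obtain ⟨s, hsR, hs1⟩ := exists_between (inv_lt_one_of_one_lt₀ hR)
  have hR0 : 0 < R := by linarith
  have hs0 : 0 < s := (inv_pos.2 hR0).trans hsR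
  have hsR' : s⁻¹ < R := (inv_lt_comm₀ hs0 hR0).2 hsR
  set G : ℂ → ℂ := conj ∘ Ψ ∘ conj with hG
  have hGd : ∀ z : ℂ, ‖z‖ < R → DifferentiableAt ℂ G z := by
    intro z hz
    rw [hG, differentiableAt_conj_conj_iff]
    exact hΨ.differentiableAt (isOpen_ball.mem_nhds (by simpa using hz))
  have hquot : ∀ r : ℝ, r ∈ Set.Icc (0 : ℝ) 1 → ∀ w : ℂ, s ≤ ‖w‖ → ‖(r : ℂ) ^ 2 / w‖ < R := by
    rintro r ⟨hr0, hr1⟩ w hw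
    rw [norm_div, norm_pow, norm_real, Real.norm_of_nonneg hr0]
    calc r ^ 2 / ‖w‖ ≤ 1 / s := by gcongr; exact pow_le_one₀ hr0 hr1
      _ < R := by rwa [one_div]
  have hshift : ∀ r ∈ Set.Ioo s 1, Real.circleAverage (fun w => conj (Ψ w) • F w) 0 r =
      Real.circleAverage (fun w => G ((r : ℂ) ^ 2 / w) • F w) 0 s := by
    rintro r ⟨hsr, hr1⟩
    have hr0 : 0 < r := hs0.trans hsr
    rw [← circleAverage_eq_of_differentiableOn_annulus hs0 hsr.le]
    · refine Real.circleAverage_congr_sphere fun w hw => ?_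
      rw [mem_sphere_zero_iff_norm, abs_of_pos hr0] at hw
      have hw0 : w ≠ 0 := by rw [← norm_pos_iff, hw]; exact hr0
      have : (r : ℂ) ^ 2 / w = conj w := by
        rw [div_eq_iff hw0, mul_comm, mul_conj', hw]
      simp [this, hG]
    · intro z hz1 hz2
      have hz0 : z ≠ 0 := by rw [← norm_pos_iff]; linarith
      have h1 : DifferentiableAt ℂ (fun w => G ((r : ℂ) ^ 2 / w)) z :=
        (hGd _ (hquot r ⟨hr0.le, hr1.le⟩ z hz1)).comp z
          ((differentiableAt_const _).div differentiableAt_id hz0)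
      exact h1.smul (hF.differentiableAt (isOpen_ball.mem_nhds (by simp; linarith)))
  have hcont : ContinuousOn (fun r : ℝ =>
      Real.circleAverage (fun w => G ((r : ℂ) ^ 2 / w) • F w) 0 s) (Set.Icc 0 1) := by
    rw [continuousOn_iff_continuous_domRestrict]
    apply (intervalIntegral.continuous_parametric_intervalIntegral_of_continuous' _ _ _).const_smul
    rw [continuous_iff_continuousAt]
    rintro ⟨⟨r, hr⟩, θ⟩
    have hw : ‖circleMap 0 s θ‖ = s := by simp [abs_of_pos hs0]
    have hw0 : circleMap 0 s θ ≠ 0 := by rw [← norm_pos_iff, hw]; exact hs0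
    have hm : ContinuousAt (fun p : Set.Icc (0 : ℝ) 1 × ℝ => circleMap 0 s p.2) (⟨r, hr⟩, θ) := by
      fun_prop
    refine ContinuousAt.smul ?_ ?_
    · refine ContinuousAt.comp (g := G)
        (f := fun p : Set.Icc (0 : ℝ) 1 × ℝ => ((p.1 : ℝ) : ℂ) ^ 2 / circleMap 0 s p.2)
        (hGd _ (hquot r hr _ hw.ge)).continuousAt (ContinuousAt.div (by fun_prop) hm hw0)
    · refine ContinuousAt.comp (g := F) (f := fun p : Set.Icc (0 : ℝ) 1 × ℝ => circleMap 0 s p.2)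
        (hF.differentiableAt (isOpen_ball.mem_nhds ?_)).continuousAt hm
      rw [mem_ball_zero_iff, hw]; exact hs1
  refine ⟨_, ((hcont 1 (by simp)).mono_left
    (nhdsWithin_le_of_mem (mem_of_superset (Ioo_mem_nhdsLT hs1)
      fun x hx => ⟨(hs0.trans hx.1).le, hx.2.le⟩))).congr' ?_⟩
  filter_upwards [Ioo_mem_nhdsLT hs1] with r hr using (hshift r hr).symm

/-- The Szegő kernel reproduces holomorphic functions in the limit. -/
lemma tendsto_circleAverage_szego [CompleteSpace E] {F : ℂ → E}
    (hF : DifferentiableOn ℂ F (ball 0 1)) {a : ℂ} (ha : ‖a‖ < 1) :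
    Tendsto (fun r : ℝ => Real.circleAverage (fun w => (1 - a * conj w)⁻¹ • F w) 0 r)
      (𝓝[<] 1) (𝓝 (F a)) := by
  have hlim : Tendsto (fun r : ℝ => F ((r : ℂ) ^ 2 * a)) (𝓝[<] 1) (𝓝 (F a)) := by
    have h1 : ContinuousAt F a :=
      (hF.differentiableAt (isOpen_ball.mem_nhds (by simpa using ha))).continuousAt
    refine h1.tendsto.comp (Tendsto.mono_left ?_ nhdsWithin_le_nhds)
    exact Continuous.tendsto' (by fun_prop) _ _ (by simp)
  refine hlim.congr' ?_
  filter_upwards [Ioo_mem_nhdsLT (zero_lt_one' ℝ)] with r ⟨hr0, hr1⟩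
  have hsub : closedBall (0 : ℂ) |r| ⊆ ball 0 1 := by
    rw [abs_of_pos hr0]; exact closedBall_subset_ball hr1
  rw [← circleAverage_sub_sub_inv_smul_of_differentiable_on_off_countable (R := r) (c := 0)
    (w := (r : ℂ) ^ 2 * a) Set.countable_empty (hF.continuousOn.mono hsub)
    (fun z hz => hF.differentiableAt (isOpen_ball.mem_nhds
      (hsub (ball_subset_closedBall hz.1))))]
  · refine Real.circleAverage_congr_sphere fun w hw => ?_
    rw [mem_sphere_zero_iff_norm, abs_of_pos hr0] at hw
    have hw0 : w ≠ 0 := by rw [← norm_pos_iff, hw]; exact hr0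
    have h2 : (r : ℂ) ^ 2 = w * conj w := by rw [mul_conj', hw]
    simp only [sub_zero, h2]
    congr 1
    rw [show w - w * conj w * a = w * (1 - a * conj w) by ring, div_mul_eq_div_div, div_self hw0,
      one_div]
  · rw [mem_ball_zero_iff, norm_mul, norm_pow, norm_real, Real.norm_of_nonneg hr0.le,
      abs_of_pos hr0]
    nlinarith [norm_nonneg a, mul_pos hr0 hr0]

lemma differentiableOn_tsum_pow_smul [CompleteSpace E] {c : ℕ → E} {C : ℝ} (hc : ∀ m, ‖c m‖ ≤ C) :
    DifferentiableOn ℂ (fun z : ℂ => ∑' m : ℕ, z ^ m • c m) (ball 0 1) := by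
  intro z hz
  rw [mem_ball_zero_iff] at hz
  obtain ⟨ρ, hzρ, hρ1⟩ := exists_between hz
  have hρ0 : 0 ≤ ρ := (norm_nonneg z).trans hzρ.le
  refine (DifferentiableOn.differentiableAt (s := ball 0 ρ)
    (differentiableOn_tsum_of_summable_norm (u := fun m => ρ ^ m * C)
      ((summable_geometric_of_lt_one hρ0 hρ1).mul_right C) (fun m => by fun_prop) isOpen_ball ?_)
    (isOpen_ball.mem_nhds (by simpa using hzρ))).differentiableWithinAt
  intro m w hw
  rw [mem_ball_zero_iff] at hw
  rw [norm_smul, norm_pow]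
  gcongr
  exact hc m

/-- The projection onto the span of the Malmquist–Takenaka functions interpolates a vector-valued
holomorphic function at the parameter points. -/
lemma complexMT_projection_interpolates [CompleteSpace E] {α : ℕ → ℂ}
    (hα : ∀ k, 1 ≤ k → ‖α k‖ < 1) {F : ℂ → E} (hF : DifferentiableOn ℂ F (ball 0 1)) (n : ℕ) :
    ∃ ip : ℕ → E,
      (∀ k ∈ Finset.Icc 1 n, Tendsto
        (fun r : ℝ => Real.circleAverage (fun w => conj (complexMT α k w) • F w) 0 r)
        (𝓝[<] 1) (𝓝 (ip k))) ∧
      ∀ l ∈ Finset.Icc 1 n, ∑ k ∈ Finset.Icc 1 n, complexMT α k (α l) • ip k = F (α l) := by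
  have hex : ∀ k, ∃ L, k ∈ Finset.Icc 1 n → Tendsto
        (fun r : ℝ => Real.circleAverage (fun w => conj (complexMT α k w) • F w) 0 r)
        (𝓝[<] 1) (𝓝 L) := by
    intro k
    by_cases hk : k ∈ Finset.Icc 1 n
    · obtain ⟨R, hR, hd⟩ := exists_differentiableOn_complexMT hα (Finset.mem_Icc.1 hk).1
      obtain ⟨L, hL⟩ := exists_tendsto_circleAverage_conj_smul hR hd hF
      exact ⟨L, fun _ => hL⟩
    · exact ⟨0, fun h => absurd h hk⟩
  choose ip hip using hex
  refine ⟨ip, hip, fun l hl => ?_⟩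
  have h1 := tendsto_finsetSum (Finset.Icc 1 n) fun k hk =>
    (hip k hk).const_smul (complexMT α k (α l))
  refine tendsto_nhds_unique h1
    ((tendsto_circleAverage_szego hF (hα l (Finset.mem_Icc.1 hl).1)).congr' ?_)
  filter_upwards [Ioo_mem_nhdsLT (zero_lt_one' ℝ)] with r ⟨hr0, hr1⟩
  have hsub : sphere (0 : ℂ) r ⊆ ball 0 1 := sphere_subset_ball hr1
  have hint : ∀ k ∈ Finset.Icc 1 n, CircleIntegrable
      (fun w => complexMT α k (α l) • conj (complexMT α k w) • F w) 0 r := by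
    intro k hk
    obtain ⟨R, hR, hd⟩ := exists_differentiableOn_complexMT hα (Finset.mem_Icc.1 hk).1
    refine ContinuousOn.circleIntegrable hr0.le (continuousOn_const.smul
      (ContinuousOn.smul (continuous_conj.comp_continuousOn ?_) (hF.continuousOn.mono hsub)))
    exact hd.continuousOn.mono (hsub.trans (ball_subset_ball hR.le))
  simp_rw [← Real.circleAverage_fun_smul]
  rw [← Real.circleAverage_fun_sum hint]
  refine Real.circleAverage_congr_sphere fun w hw => ?_
  rw [mem_sphere_zero_iff_norm, abs_of_pos hr0] at hw
  simp only [← sum_complexMT_mul_conj hα hl (hw.trans_le hr1.le), Finset.sum_smul, smul_smul]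

end CircleAverage

section Slice

variable {I : Quaternion ℝ}

/-- The embedding of `ℂ` onto the slice `L_I`. -/
def sliceEmbedding (hI : I ^ 2 = -1) : ℂ →ₐ[ℝ] Quaternion ℝ :=
  Complex.liftAux I (by rw [← sq, hI])

lemma sliceEmbedding_apply (hI : I ^ 2 = -1) (z : ℂ) :
    sliceEmbedding hI z = (z.re : Quaternion ℝ) + z.im • I := rfl

lemma star_eq_neg_of_sq_eq_neg_one (hI : I ^ 2 = -1) : star I = -I := by
  have h1 : ‖I‖ ^ 2 = 1 := by rw [← norm_pow, hI, norm_neg, norm_one]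
  rw [Quaternion.star_eq_neg, ← Quaternion.sq_eq_neg_normSq, Quaternion.normSq_eq_norm_mul_self,
    ← sq, h1, hI, Quaternion.coe_one]

lemma star_sliceEmbedding (hI : I ^ 2 = -1) (z : ℂ) :
    star (sliceEmbedding hI z) = sliceEmbedding hI (conj z) := by
  simp [sliceEmbedding_apply, star_eq_neg_of_sq_eq_neg_one hI]

lemma norm_sliceEmbedding (hI : I ^ 2 = -1) (z : ℂ) : ‖sliceEmbedding hI z‖ = ‖z‖ := by
  have h : ((‖sliceEmbedding hI z‖ * ‖sliceEmbedding hI z‖ : ℝ) : Quaternion ℝ) =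
      ((‖z‖ ^ 2 : ℝ) : Quaternion ℝ) := by
    rw [← Quaternion.normSq_eq_norm_mul_self, ← Quaternion.self_mul_star, star_sliceEmbedding,
      ← map_mul, mul_conj', ← ofReal_pow, sliceEmbedding_apply, ofReal_re, ofReal_im, zero_smul,
      add_zero]
  rw [Quaternion.coe_inj, ← sq] at h
  exact (pow_left_inj₀ (norm_nonneg _) (norm_nonneg _) two_ne_zero).1 h

lemma smul_expI_eq_sliceEmbedding (hI : I ^ 2 = -1) (r θ : ℝ) :
    r • expI I θ = sliceEmbedding hI (circleMap 0 r θ) := by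
  rw [circleMap_zero, ← real_smul, map_smul, expI, sliceEmbedding_apply, exp_ofReal_mul_I_re,
    exp_ofReal_mul_I_im]

lemma B_sliceEmbedding (hI : I ^ 2 = -1) (a z : ℂ) :
    B (sliceEmbedding hI a) (sliceEmbedding hI z) = sliceEmbedding hI (complexBlaschke a z) := by
  simp [B, complexBlaschke, star_sliceEmbedding, map_inv₀]

lemma Phi_sliceEmbedding (hI : I ^ 2 = -1) {a : ℕ → Quaternion ℝ} {α : ℕ → ℂ}
    (hα : ∀ k, 1 ≤ k → sliceEmbedding hI (α k) = a k) {n : ℕ} (hn : 1 ≤ n) (z : ℂ) :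
    Phi a n (sliceEmbedding hI z) = sliceEmbedding hI (complexMT α n z) := by
  have hprod : ∀ m, ((List.range m).map (fun k => B (a (k + 1)) (sliceEmbedding hI z))).prod =
      sliceEmbedding hI (∏ k ∈ Finset.range m, complexBlaschke (α (k + 1)) z) := by
    intro m
    induction m with
    | zero => simp
    | succ m ih =>
      rw [List.range_succ, List.map_append, List.prod_append, ih, Finset.prod_range_succ, map_mul,
        ← B_sliceEmbedding, hα _ m.succ_pos]
      simp
  have hreal : ∀ x : ℝ, sliceEmbedding hI (x : ℂ) = (x : Quaternion ℝ) := fun x => by simp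
  simp only [Phi, complexMT, hprod, map_mul, map_inv₀, map_sub, map_one, hreal]
  rw [← star_sliceEmbedding, hα n hn, ← hα n hn, norm_sliceEmbedding]

/-- The quaternions as a complex normed space, with `ℂ` acting by left multiplication through the
slice `L_I`. -/
abbrev sliceNormedSpace (hI : I ^ 2 = -1) : NormedSpace ℂ (Quaternion ℝ) where
  toModule := Module.compHom (Quaternion ℝ) (sliceEmbedding hI).toRingHom
  norm_smul_le z q := by
    change ‖sliceEmbedding hI z * q‖ ≤ ‖z‖ * ‖q‖
    rw [norm_mul, norm_sliceEmbedding]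

end Slice

/-- **Theorem 5.1** (interpolation property of the projection operator): for parameters
on a slice, the inner products `⟨f, Φ_k⟩` exist as boundary limits and the projection
`P_n f(z) = ∑_{k=1}^n Φ_k(z)·⟨f, Φ_k⟩` interpolates `f` at the points `a_1, …, a_n`. -/
theorem MT_projection_interpolates
    (I : Quaternion ℝ) (hI : I ^ 2 = -1)
    (a : ℕ → Quaternion ℝ)
    (ha_slice : ∀ k, 1 ≤ k → ∃ x y : ℝ, a k = (x : Quaternion ℝ) + y • I)
    (ha_norm : ∀ k, 1 ≤ k → ‖a k‖ < 1)
    (c : ℕ → Quaternion ℝ) (hc : Summable (fun m => ‖c m‖ ^ 2))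
    (f : Quaternion ℝ → Quaternion ℝ)
    (hf : ∀ q : Quaternion ℝ, ‖q‖ < 1 → f q = ∑' m : ℕ, q ^ m * c m)
    (n : ℕ) (hn : 1 ≤ n) :
    ∃ ip : ℕ → Quaternion ℝ,
      (∀ k ∈ Finset.Icc 1 n,
        Filter.Tendsto (fun r : ℝ =>
            (1 / (2 * π)) • ∫ θ in (0:ℝ)..(2 * π),
              star (Phi a k (r • expI I θ)) * f (r • expI I θ))
          (nhdsWithin 1 (Set.Iio 1)) (nhds (ip k))) ∧
      (∀ ℓ ∈ Finset.Icc 1 n,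
        ∑ k ∈ Finset.Icc 1 n, Phi a k (a ℓ) * ip k = f (a ℓ)) := by
  let _ : NormedSpace ℂ (Quaternion ℝ) := sliceNormedSpace hI
  have hsmul : ∀ (z : ℂ) (q : Quaternion ℝ), z • q = sliceEmbedding hI z * q := fun _ _ => rfl
  have hreal : (NormedSpace.complexToReal : NormedSpace ℝ (Quaternion ℝ)) =
      InnerProductSpace.toNormedSpace := by
    refine NormedSpace.ext (funext₂ fun r q => ?_)
    change sliceEmbedding hI (r : ℂ) * q = r • q
    simp [Quaternion.coe_mul_eq_smul]
  have hα : ∀ k, ∃ α : ℂ, 1 ≤ k → sliceEmbedding hI α = a k := by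
    intro k
    by_cases hk : 1 ≤ k
    · obtain ⟨x, y, h⟩ := ha_slice k hk
      exact ⟨⟨x, y⟩, fun _ => h.symm⟩
    · exact ⟨0, fun h => absurd h hk⟩
  choose α hα using hα
  have hα1 : ∀ k, 1 ≤ k → ‖α k‖ < 1 := fun k hk => by
    rw [← norm_sliceEmbedding hI, hα k hk]
    exact ha_norm k hk
  obtain ⟨C, hC⟩ : ∃ C, ∀ m, ‖c m‖ ≤ C := by
    obtain ⟨C, hC⟩ := hc.tendsto_atTop_zero.bddAbove_range
    refine ⟨C + 1, fun m => ?_⟩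
    nlinarith [hC ⟨m, rfl⟩, sq_nonneg (‖c m‖ - 1)]
  have hF : DifferentiableOn ℂ (fun z => f (sliceEmbedding hI z)) (ball 0 1) := by
    refine (differentiableOn_tsum_pow_smul hC).congr fun z hz => ?_
    rw [hf _ (by rw [norm_sliceEmbedding]; simpa using hz)]
    simp only [hsmul, map_pow]
  obtain ⟨ip, hip, hsum⟩ := complexMT_projection_interpolates hα1 hF n
  refine ⟨ip, fun k hk => ?_, fun l hl => ?_⟩
  · have h := hip k hk
    rw [hreal] at h
    simp only [Real.circleAverage_def, hsmul] at h
    simpa only [one_div, smul_expI_eq_sliceEmbedding hI,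
      Phi_sliceEmbedding hI hα (Finset.mem_Icc.1 hk).1, star_sliceEmbedding] using h
  · have h := hsum l hl
    rw [hα l (Finset.mem_Icc.1 hl).1] at h
    rw [← h]
    refine Finset.sum_congr rfl fun k hk => ?_
    rw [hsmul, ← hα l (Finset.mem_Icc.1 hl).1,
      Phi_sliceEmbedding hI hα (Finset.mem_Icc.1 hk).1]
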